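/- arXiv:1602.02454 — 2 statements merged into one kernel-verified Lean document; each statement's English description precedes it below -/
import Mathlib

section
/- In the transductive Context-FTPL setup, the expected Laplacian error satisfies: E[ max_{π ∈ Π} Σ_{x ∈ X} ⟨π(x), ℓ_x⟩ ] ≤ (5/ε)·√(d·m)·log N, and consequently Error := E[ max_{π ∈ Π} Σ_{x ∈ X} ⟨π(x), ℓ_x⟩ ] − E[ min_{π ∈ Π} Σ_{x ∈ X} ⟨π(x), ℓ_x⟩ ] ≤ (10/ε)·√(d·m)·log N, where the expectation is over the i.i.d. Laplace(ε) perturbation (ℓ_x(j))_{x ∈ X, j ∈ {1,…,K}}. (Lemma: Laplacian Error Bound.) -/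
open MeasureTheory Finset

/-- The i.i.d. product Laplace(ε) measure on `ι → ℝ`: density
`z ↦ ∏ i (ε/2)·exp(−ε|z i|)` with respect to Lebesgue measure. -/
noncomputable def laplacePi (ι : Type*) [Fintype ι] (ε : ℝ) :
    MeasureTheory.Measure (ι → ℝ) :=
  (MeasureTheory.volume : MeasureTheory.Measure (ι → ℝ)).withDensity
    fun z => ENNReal.ofReal (∏ i, ε / 2 * Real.exp (-ε * |z i|))

/-- `⟨a, v⟩` for `a ∈ {0,1}^K` (as a Boolean vector) and `v ∈ ℝ^K`. -/
def dotp {K : ℕ} (a : Fin K → Bool) (v : Fin K → ℝ) : ℝ :=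
  ∑ j, if a j then v j else 0

theorem hasIntegral_laplace_mgf {ε t : ℝ} (ht : |t| < ε) :
    Integrable (fun x : ℝ => ε / 2 * Real.exp (-ε * |x|) * Real.exp (t * x)) ∧
      ∫ x : ℝ, ε / 2 * Real.exp (-ε * |x|) * Real.exp (t * x) = ε ^ 2 / (ε ^ 2 - t ^ 2) := by
  obtain ⟨h₁, h₂⟩ := abs_lt.1 ht
  have hneg : Set.EqOn (fun x : ℝ => ε / 2 * Real.exp (-ε * |x|) * Real.exp (t * x))
      (fun x => ε / 2 * Real.exp ((ε + t) * x)) (Set.Iic 0) := by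
    intro x hx
    simp only [abs_of_nonpos (Set.mem_Iic.1 hx), mul_assoc, ← Real.exp_add]
    ring_nf
  have hpos : Set.EqOn (fun x : ℝ => ε / 2 * Real.exp (-ε * |x|) * Real.exp (t * x))
      (fun x => ε / 2 * Real.exp ((t - ε) * x)) (Set.Ioi 0) := by
    intro x hx
    simp only [abs_of_pos (Set.mem_Ioi.1 hx), mul_assoc, ← Real.exp_add]
    ring_nf
  have hineg := IntegrableOn.congr_fun
    ((integrableOn_exp_mul_Iic (by linarith : 0 < ε + t) 0).const_mul (ε / 2))
    hneg.symm measurableSet_Iic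
  have hipos := IntegrableOn.congr_fun
    ((integrableOn_exp_mul_Ioi (by linarith : t - ε < 0) 0).const_mul (ε / 2))
    hpos.symm measurableSet_Ioi
  refine ⟨?_, ?_⟩
  · rw [← integrableOn_univ, ← Set.Iic_union_Ioi (a := (0 : ℝ))]
    exact hineg.union hipos
  · rw [← intervalIntegral.integral_Iic_add_Ioi hineg hipos,
      setIntegral_congr_fun measurableSet_Iic hneg, setIntegral_congr_fun measurableSet_Ioi hpos,
      integral_const_mul, integral_const_mul, integral_exp_mul_Iic (by linarith),
      integral_exp_mul_Ioi (by linarith)]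
    have h₃ : ε + t ≠ 0 := by linarith
    have h₄ : t - ε ≠ 0 := by linarith
    have h₅ : ε ^ 2 - t ^ 2 ≠ 0 := by
      rw [sq_sub_sq]
      exact mul_ne_zero h₃ (by linarith)
    simp only [mul_zero, Real.exp_zero]
    field_simp
    ring

theorem laplacePi_mgf {ι : Type*} [Fintype ι] {ε : ℝ} {a : ι → ℝ} (ha : ∀ i, |a i| < ε) :
    Integrable (fun z : ι → ℝ => Real.exp (∑ i, a i * z i)) (laplacePi ι ε) ∧
      ∫ z, Real.exp (∑ i, a i * z i) ∂(laplacePi ι ε) = ∏ i, ε ^ 2 / (ε ^ 2 - a i ^ 2) := by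
  have hmeas : Measurable fun z : ι → ℝ =>
      ENNReal.ofReal (∏ i, ε / 2 * Real.exp (-ε * |z i|)) := by fun_prop
  have hfin : ∀ᵐ z : ι → ℝ, ENNReal.ofReal (∏ i, ε / 2 * Real.exp (-ε * |z i|)) < ⊤ :=
    .of_forall fun _ => ENNReal.ofReal_lt_top
  have hprod : (fun z : ι → ℝ => (ENNReal.ofReal (∏ i, ε / 2 * Real.exp (-ε * |z i|))).toReal •
      Real.exp (∑ i, a i * z i)) =
      fun z => ∏ i, ε / 2 * Real.exp (-ε * |z i|) * Real.exp (a i * z i) := by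
    funext z
    have hnonneg : 0 ≤ ∏ i, ε / 2 * Real.exp (-ε * |z i|) := Finset.prod_nonneg fun i _ =>
      mul_nonneg (by linarith [abs_nonneg (a i), ha i]) (Real.exp_pos _).le
    rw [ENNReal.toReal_ofReal hnonneg, Real.exp_sum, smul_eq_mul, ← Finset.prod_mul_distrib]
  rw [laplacePi, integrable_withDensity_iff_integrable_smul' hmeas hfin,
    integral_withDensity_eq_integral_toReal_smul hmeas hfin, hprod]
  refine ⟨Integrable.fintype_prod fun i => (hasIntegral_laplace_mgf (ha i)).1, ?_⟩
  rw [integral_fintype_prod_volume_eq_prod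
    fun i (x : ℝ) => ε / 2 * Real.exp (-ε * |x|) * Real.exp (a i * x)]
  exact Finset.prod_congr rfl fun i _ => (hasIntegral_laplace_mgf (ha i)).2

theorem isProbabilityMeasure_laplacePi (ι : Type*) [Fintype ι] {ε : ℝ} (hε : 0 < ε) :
    IsProbabilityMeasure (laplacePi ι ε) := by
  have h := laplacePi_mgf (ι := ι) (a := fun _ => 0) (ε := ε) fun _ => by simpa using hε
  have hone : ε ^ 2 / (ε ^ 2 - 0 ^ 2) = 1 := by field_simp; simp
  simp only [zero_mul, Finset.sum_const_zero, Real.exp_zero, hone, Finset.prod_const_one,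
    integral_const, smul_eq_mul, mul_one] at h
  exact ⟨by simpa [Measure.real, ENNReal.toReal_eq_one_iff] using h.2⟩

theorem one_div_one_sub_le_exp {x y : ℝ} (hx : 0 ≤ x) (hxy : x ≤ y) (hy : y < 1) :
    1 / (1 - x) ≤ Real.exp (x / (1 - y)) :=
  calc 1 / (1 - x) = x / (1 - x) + 1 := by
        have : 1 - x ≠ 0 := by linarith
        field_simp
        ring
    _ ≤ Real.exp (x / (1 - x)) := Real.add_one_le_exp _
    _ ≤ Real.exp (x / (1 - y)) := by
        gcongr

/-- A Laplace linear form with coefficients of modulus at most `1` and squared Euclidean norm at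
most `n`, evaluated at the scale `ε / (2 √n)`, has moment generating function at most `e^{1/3}`. -/
theorem laplacePi_mgf_le {ι : Type*} [Fintype ι] {ε n : ℝ} (hε : 0 < ε) (hn : 1 ≤ n)
    {c : ι → ℝ} (hc : ∀ i, |c i| ≤ 1) (hcn : ∑ i, c i ^ 2 ≤ n) :
    Integrable (fun z : ι → ℝ => Real.exp (ε / (2 * √n) * ∑ i, c i * z i)) (laplacePi ι ε) ∧
      ∫ z, Real.exp (ε / (2 * √n) * ∑ i, c i * z i) ∂(laplacePi ι ε) ≤ Real.exp (1 / 3) := by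
  have hsqrt : 1 ≤ √n := Real.one_le_sqrt.2 hn
  have hsq : √n ^ 2 = n := Real.sq_sqrt (by linarith)
  have hsmall : ∀ i, |ε / (2 * √n) * c i| < ε := by
    intro i
    rw [abs_mul, abs_of_pos (by positivity)]
    calc ε / (2 * √n) * |c i| ≤ ε / (2 * √n) * 1 := by gcongr; exact hc i
      _ < ε := by
        rw [mul_one, div_lt_iff₀ (by positivity)]
        nlinarith
  have h := laplacePi_mgf hsmall
  simp only [mul_assoc, ← Finset.mul_sum] at h
  refine ⟨h.1, h.2.trans_le ?_⟩
  have hfactor : ∀ i, ε ^ 2 / (ε ^ 2 - (ε / (2 * √n) * c i) ^ 2) ≤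
      Real.exp (c i ^ 2 / (3 * n)) := by
    intro i
    have hci : c i ^ 2 ≤ 1 := (sq_le_one_iff_abs_le_one _).2 (hc i)
    have hle : c i ^ 2 / (4 * n) ≤ 1 / 4 := by
      rw [div_le_div_iff₀ (by positivity) (by norm_num)]
      nlinarith
    have hbound := one_div_one_sub_le_exp (by positivity) hle (by norm_num)
    have hlhs : ε ^ 2 / (ε ^ 2 - (ε / (2 * √n) * c i) ^ 2) = 1 / (1 - c i ^ 2 / (4 * n)) := by
      have : ε ^ 2 - (ε / (2 * √n) * c i) ^ 2 = ε ^ 2 * (1 - c i ^ 2 / (4 * n)) := by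
        rw [mul_pow, div_pow, mul_pow, hsq]
        ring
      rw [this, ← div_div, div_self (by positivity)]
    have hrhs : c i ^ 2 / (4 * n) / (1 - 1 / 4) = c i ^ 2 / (3 * n) := by
      field_simp
      norm_num
    rwa [hlhs, ← hrhs]
  calc ∏ i, ε ^ 2 / (ε ^ 2 - (ε / (2 * √n) * c i) ^ 2)
      ≤ ∏ i, Real.exp (c i ^ 2 / (3 * n)) := by
        refine Finset.prod_le_prod (fun i _ => div_nonneg (sq_nonneg _) ?_) fun i _ => hfactor i
        have := sq_lt_sq' (abs_lt.1 (hsmall i)).1 (abs_lt.1 (hsmall i)).2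
        linarith
    _ = Real.exp ((∑ i, c i ^ 2) / (3 * n)) := by rw [← Real.exp_sum, Finset.sum_div]
    _ ≤ Real.exp (1 / 3) := by
        refine Real.exp_le_exp.2 ?_
        rw [div_le_div_iff₀ (by positivity) (by norm_num)]
        linarith

/-- Maximal inequality for finitely many Laplace linear forms; `M` need not be integrable. -/
theorem integral_laplacePi_le_of_exists_le {ι P : Type*} [Fintype ι] [Fintype P] {ε n : ℝ}
    (hε : 0 < ε) (hn : n = 0 ∨ 1 ≤ n) (hP : 2 ≤ Fintype.card P) {c : P → ι → ℝ}
    (hc : ∀ p i, |c p i| ≤ 1) (hcn : ∀ p, ∑ i, c p i ^ 2 ≤ n) {M : (ι → ℝ) → ℝ}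
    (hM : ∀ z, ∃ p, M z ≤ ∑ i, c p i * z i) :
    ∫ z, M z ∂(laplacePi ι ε) ≤ 5 / ε * √n * Real.log (Fintype.card P) := by
  have hcard : (2 : ℝ) ≤ Fintype.card P := by exact_mod_cast hP
  have hlog : 0.69 ≤ Real.log (Fintype.card P) :=
    le_trans (by linarith [Real.log_two_gt_d9]) (Real.log_le_log (by norm_num) hcard)
  have hrhs : 0 ≤ 5 / ε * √n * Real.log (Fintype.card P) :=
    mul_nonneg (by positivity) (by linarith)
  rcases hn with rfl | hn
  · refine (integral_nonpos fun z => ?_).trans hrhs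
    obtain ⟨p, hp⟩ := hM z
    refine hp.trans_eq (Finset.sum_eq_zero fun i _ => ?_)
    have hle : c p i ^ 2 ≤ 0 :=
      (Finset.single_le_sum (f := fun i => c p i ^ 2) (fun _ _ => sq_nonneg _)
        (Finset.mem_univ i)).trans (hcn p)
    rw [pow_eq_zero_iff two_ne_zero |>.1 (le_antisymm hle (sq_nonneg _)), zero_mul]
  by_cases hMint : Integrable M (laplacePi ι ε)
  swap
  · rwa [integral_undef hMint]
  have := isProbabilityMeasure_laplacePi ι hε
  have hsqrt : 1 ≤ √n := Real.one_le_sqrt.2 hn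
  set s : ℝ := ε / (2 * √n) with hs
  have hspos : 0 < s := by positivity
  set L : ℝ := Real.log (Fintype.card P) + 1 / 3 with hL
  have hexpL : Real.exp L = Fintype.card P * Real.exp (1 / 3) := by
    rw [hL, Real.exp_add, Real.exp_log (by linarith)]
  have hmgf := fun p => laplacePi_mgf_le hε hn (hc p) (hcn p)
  simp only [← hs] at hmgf
  have hpoint : ∀ z, s * M z ≤
      (∑ p, Real.exp (s * ∑ i, c p i * z i)) * Real.exp (-L) + (L - 1) := by
    intro z
    obtain ⟨p, hp⟩ := hM z
    have hle : Real.exp (s * M z) ≤ ∑ p, Real.exp (s * ∑ i, c p i * z i) :=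
      (Real.exp_le_exp.2 (mul_le_mul_of_nonneg_left hp hspos.le)).trans
        (Finset.single_le_sum (f := fun p => Real.exp (s * ∑ i, c p i * z i))
          (fun _ _ => (Real.exp_pos _).le) (Finset.mem_univ p))
    have htangent := Real.add_one_le_exp (s * M z + -L)
    rw [Real.exp_add] at htangent
    have := mul_le_mul_of_nonneg_right hle (Real.exp_pos (-L)).le
    linarith
  have hsumint : Integrable (fun z => ∑ p, Real.exp (s * ∑ i, c p i * z i)) (laplacePi ι ε) :=
    integrable_finsetSum _ fun p _ => (hmgf p).1
  have hintegral : s * ∫ z, M z ∂(laplacePi ι ε) ≤ L := by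
    calc s * ∫ z, M z ∂(laplacePi ι ε) = ∫ z, s * M z ∂(laplacePi ι ε) :=
          (integral_const_mul _ _).symm
      _ ≤ ∫ z, (∑ p, Real.exp (s * ∑ i, c p i * z i)) * Real.exp (-L) + (L - 1)
            ∂(laplacePi ι ε) :=
          integral_mono (hMint.const_mul _)
            ((hsumint.mul_const _).add (integrable_const _)) hpoint
      _ = (∑ p, ∫ z, Real.exp (s * ∑ i, c p i * z i) ∂(laplacePi ι ε)) * Real.exp (-L) +
            (L - 1) := by
          rw [integral_add (hsumint.mul_const _) (integrable_const _), integral_mul_const,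
            integral_finsetSum _ fun p _ => (hmgf p).1]
          simp
      _ ≤ (∑ _p : P, Real.exp (1 / 3)) * Real.exp (-L) + (L - 1) := by
          gcongr with p
          exact (hmgf p).2
      _ = L := by
          rw [Finset.sum_const, Finset.card_univ, nsmul_eq_mul, ← hexpL, ← Real.exp_add]
          simp
  calc ∫ z, M z ∂(laplacePi ι ε) ≤ L / s := (le_div_iff₀' hspos).2 hintegral
    _ = 2 / ε * √n * L := by
        rw [hs]
        field_simp
    _ ≤ 2 / ε * √n * (5 / 2 * Real.log (Fintype.card P)) := by
        gcongr
        linarith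
    _ = 5 / ε * √n * Real.log (Fintype.card P) := by ring

theorem sum_dotp_eq_sum {X : Type*} [Fintype X] {K : ℕ} (b : X → Fin K → Bool)
    (z : X × Fin K → ℝ) :
    ∑ x, dotp (b x) (fun j => z (x, j)) = ∑ i, (if b i.1 i.2 then 1 else 0) * z i := by
  simp [dotp, Fintype.sum_prod_type]

/-- **Laplacian Error Bound** (transductive Context-FTPL setup).
`X` is the finite set of `d` contexts, `P` the finite set of `N ≥ 2` policies
(given by their evaluation map `pol`), each policy choosing at most `m` of the
`K` coordinates.  The perturbation `(ℓ_x(j))_{x,j}` consists of `d·K` i.i.d.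
Laplace(ε) coordinates.  Then the expected maximum perturbed loss is at most
`(5/ε)√(dm)·log N` and the Error term is at most `(10/ε)√(dm)·log N`. -/
theorem laplacian_error_bound
    {X P : Type*} [Fintype X] [Fintype P] [Nonempty P]
    {K m d N : ℕ} (hK : 1 ≤ K) (hm : 1 ≤ m)
    (hd : Fintype.card X = d) (hN : Fintype.card P = N) (hN2 : 2 ≤ N)
    (pol : P → X → Fin K → Bool)
    (hsparse : ∀ p x, (Finset.univ.filter fun j => pol p x j = true).card ≤ m)
    {ε : ℝ} (hε : 0 < ε) :
    (∫ z, (Finset.univ.sup' Finset.univ_nonempty fun p : P =>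
          ∑ x : X, dotp (pol p x) fun j => z (x, j))
        ∂(laplacePi (X × Fin K) ε)) ≤
        5 / ε * Real.sqrt ((d : ℝ) * (m : ℝ)) * Real.log N ∧
    (∫ z, (Finset.univ.sup' Finset.univ_nonempty fun p : P =>
          ∑ x : X, dotp (pol p x) fun j => z (x, j))
        ∂(laplacePi (X × Fin K) ε)) -
      (∫ z, (Finset.univ.inf' Finset.univ_nonempty fun p : P =>
          ∑ x : X, dotp (pol p x) fun j => z (x, j))
        ∂(laplacePi (X × Fin K) ε)) ≤
        10 / ε * Real.sqrt ((d : ℝ) * (m : ℝ)) * Real.log N := by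
  subst hd hN
  have hn : (Fintype.card X : ℝ) * m = 0 ∨ 1 ≤ (Fintype.card X : ℝ) * m := by
    rcases Nat.eq_zero_or_pos (Fintype.card X * m) with h | h
    · exact .inl (by exact_mod_cast h)
    · exact .inr (by exact_mod_cast h)
  have hnorm : ∀ p, ∑ i : X × Fin K, (if pol p i.1 i.2 then (1 : ℝ) else 0) ^ 2 ≤
      (Fintype.card X : ℝ) * m := by
    intro p
    calc ∑ i : X × Fin K, (if pol p i.1 i.2 then (1 : ℝ) else 0) ^ 2
        = ∑ x, ((Finset.univ.filter fun j => pol p x j = true).card : ℝ) := by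
          rw [Fintype.sum_prod_type]
          simp
      _ ≤ ∑ _x : X, (m : ℝ) := Finset.sum_le_sum fun x _ => by exact_mod_cast hsparse p x
      _ = (Fintype.card X : ℝ) * m := by simp
  simp only [sum_dotp_eq_sum]
  have hsup : (∫ z, (Finset.univ.sup' Finset.univ_nonempty fun p : P =>
      ∑ i : X × Fin K, (if pol p i.1 i.2 then 1 else 0) * z i) ∂(laplacePi (X × Fin K) ε)) ≤
      5 / ε * √((Fintype.card X : ℝ) * m) * Real.log (Fintype.card P) := by
    refine integral_laplacePi_le_of_exists_le hε hn hN2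
      (c := fun p i => if pol p i.1 i.2 then 1 else 0) ?_ hnorm fun z => ?_
    · intro p i
      split_ifs <;> simp
    · obtain ⟨p, -, hp⟩ := Finset.exists_mem_eq_sup' Finset.univ_nonempty fun p : P =>
        ∑ i : X × Fin K, (if pol p i.1 i.2 then 1 else 0) * z i
      exact ⟨p, hp.le⟩
  have hinf : (∫ z, -(Finset.univ.inf' Finset.univ_nonempty fun p : P =>
      ∑ i : X × Fin K, (if pol p i.1 i.2 then 1 else 0) * z i) ∂(laplacePi (X × Fin K) ε)) ≤
      5 / ε * √((Fintype.card X : ℝ) * m) * Real.log (Fintype.card P) := by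
    refine integral_laplacePi_le_of_exists_le hε hn hN2
      (c := fun p i => -if pol p i.1 i.2 then 1 else 0) ?_
      (fun p => by simpa only [neg_sq] using hnorm p) fun z => ?_
    · intro p i
      split_ifs <;> simp
    · obtain ⟨p, -, hp⟩ := Finset.exists_mem_eq_inf' Finset.univ_nonempty fun p : P =>
        ∑ i : X × Fin K, (if pol p i.1 i.2 then 1 else 0) * z i
      exact ⟨p, by simp only [hp, neg_mul, Finset.sum_neg_distrib, le_refl]⟩
  rw [integral_neg] at hinf
  refine ⟨hsup, ?_⟩
  linarith [show 10 / ε * √((Fintype.card X : ℝ) * m) * Real.log (Fintype.card P) =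
    2 * (5 / ε * √((Fintype.card X : ℝ) * m) * Real.log (Fintype.card P)) by ring]
end

section
/- In the small-separator Context-FTPL setup, fix a sequence (x^1,f^1),…,(x^T,f^T) of contexts x^τ ∈ 𝒳 and loss functions f^τ : {0,1}^K → ℝ, and for each t let π^t be the smallest (tie-breaking order) minimizer over π ∈ Π of Σ_{τ=1}^{t−1} f^τ(π(x^τ)) + Σ_{x ∈ X} ⟨π(x), ℓ_x⟩. Then the expected regret satisfies: E[ Σ_{t=1}^T f^t(π^t(x^t)) ] − min_{π* ∈ Π} Σ_{t=1}^T f^t(π*(x^t)) ≤ 4·ε·K·d·Σ_{t=1}^T ‖f^t‖_*² + (10/ε)·√(d·m)·log N, where the expectation is over the i.i.d. Laplace(ε) perturbation. (Regret bound for Context-FTPL in the small-separator setting, oblivious-adversary form.) -/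
open MeasureTheory Finset

/-- `‖f‖_* = max_{a ∈ {0,1}^K} |f a|` for a loss function `f`. -/
noncomputable def dualNorm {K : ℕ} (f : (Fin K → Bool) → ℝ) : ℝ :=
  Finset.univ.sup' ⟨fun _ => false, Finset.mem_univ _⟩ fun a => |f a|

/-- The smallest (in the tie-breaking linear order) minimizer of `c` over the
finite nonempty policy set `P`. -/
noncomputable def argminTie {P : Type*} [Fintype P] [Nonempty P] [LinearOrder P]
    (c : P → ℝ) : P :=
  haveI := Classical.decPred fun p : P => ∀ q, c p ≤ c q
  (Finset.univ.filter fun p : P => ∀ q, c p ≤ c q).min' (by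
    obtain ⟨p, -, hp⟩ := Finset.exists_min_image (Finset.univ : Finset P) c
      ⟨Classical.arbitrary P, Finset.mem_univ _⟩
    exact ⟨p, Finset.mem_filter.mpr ⟨Finset.mem_univ _, fun q => hp q (Finset.mem_univ q)⟩⟩)

lemma argminTie_le {P : Type*} [Fintype P] [Nonempty P] [LinearOrder P] (c : P → ℝ) (q : P) :
    c (argminTie c) ≤ c q := by
  classical
  have h := Finset.min'_mem (Finset.univ.filter fun p : P => ∀ q, c p ≤ c q) (by
    obtain ⟨p, -, hp⟩ := Finset.exists_min_image (Finset.univ : Finset P) c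
      ⟨Classical.arbitrary P, Finset.mem_univ _⟩
    exact ⟨p, Finset.mem_filter.mpr ⟨Finset.mem_univ _, fun q => hp q (Finset.mem_univ q)⟩⟩)
  have h' := (Finset.mem_filter.mp h).2 q
  unfold argminTie
  convert h'

lemma argminTie_eq_iff {P : Type*} [Fintype P] [Nonempty P] [LinearOrder P] (c : P → ℝ) (p : P) :
    argminTie c = p ↔ (∀ q, c p ≤ c q) ∧ ∀ r, (∀ q, c r ≤ c q) → p ≤ r := by
  have hmin : ∀ r, (∀ q, c r ≤ c q) → argminTie c ≤ r := fun r hr => by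
    unfold argminTie
    exact Finset.min'_le _ _ (by simpa using hr)
  constructor
  · rintro rfl
    exact ⟨argminTie_le c, hmin⟩
  · rintro ⟨h1, h2⟩
    exact le_antisymm (hmin p h1) (h2 _ (argminTie_le c))

lemma measurableSet_argminTie_eq {Ω P : Type*} [MeasurableSpace Ω] [Fintype P] [Nonempty P]
    [LinearOrder P] {c : Ω → P → ℝ} (hc : ∀ p, Measurable fun ω => c ω p) (p : P) :
    MeasurableSet {ω | argminTie (c ω) = p} := by
  have hle : ∀ p : P, MeasurableSet {ω | ∀ q, c ω p ≤ c ω q} := fun p => by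
    rw [Set.ofPred_forall]
    exact MeasurableSet.iInter fun q => measurableSet_le (hc p) (hc q)
  simp only [argminTie_eq_iff, Set.ofPred_and, Set.ofPred_forall]
  refine (by simpa only [Set.ofPred_forall] using hle p : MeasurableSet _).inter
    (MeasurableSet.iInter fun r => ?_)
  by_cases hpr : p ≤ r
  · simp [hpr]
  · simp only [hpr, imp_false]
    exact (hle r).compl

/-- Every function of a measurable tie-broken argmin is measurable. -/
lemma measurable_comp_argminTie {Ω P β : Type*} [MeasurableSpace Ω] [MeasurableSpace β]
    [Fintype P] [Nonempty P] [LinearOrder P] {c : Ω → P → ℝ}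
    (hc : ∀ p, Measurable fun ω => c ω p) (g : P → β) :
    Measurable fun ω => g (argminTie (c ω)) := by
  let _ : MeasurableSpace P := ⊤
  have h : Measurable fun ω => argminTie (c ω) :=
    measurable_to_countable' fun p => measurableSet_argminTie_eq hc p
  exact (measurable_from_top (f := g)).comp h

/-- Be-the-leader inequality. -/
lemma sum_argminTie_succ_le {P : Type*} [Fintype P] [Nonempty P] [LinearOrder P]
    (a : ℕ → P → ℝ) (R : P → ℝ) (T : ℕ) (p : P) :
    ∑ t ∈ range T, a t (argminTie fun q => ∑ τ ∈ range (t + 1), a τ q + R q) +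
        R (argminTie fun q => ∑ τ ∈ range 0, a τ q + R q) ≤
      ∑ t ∈ range T, a t p + R p := by
  induction T generalizing p with
  | zero =>
    have h := argminTie_le (fun q => ∑ τ ∈ range 0, a τ q + R q) p
    simpa using h
  | succ T ih =>
    have h := argminTie_le (fun q => ∑ τ ∈ range (T + 1), a τ q + R q) p
    have h' := ih (argminTie fun q => ∑ τ ∈ range (T + 1), a τ q + R q)
    rw [sum_range_succ]
    simp only [sum_range_succ _ T] at h h' ⊢
    linarith

/-- The values of one coordinate of the perturbation for which a change of the costs by at most
`F` flips that coordinate of the minimizer lie in an interval of length `4 * F`. -/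
lemma exists_center_of_flip {P : Type*} [Fintype P] (c c' : P → ℝ) (β : P → Bool) {F : ℝ}
    (hF : ∀ p, |c' p - c p| ≤ F) :
    ∃ ν : ℝ, ∀ (s : ℝ) (p q : P),
      (∀ r, c p + (if β p then s else 0) ≤ c r + (if β r then s else 0)) →
      (∀ r, c' q + (if β q then s else 0) ≤ c' r + (if β r then s else 0)) →
      β p ≠ β q → s ∈ Set.Icc (ν - 2 * F) (ν + 2 * F) := by
  by_cases h1 : ∃ p, β p = true
  swap
  · refine ⟨0, fun s p q _ _ h => absurd ?_ h⟩
    simp only [not_exists, Bool.not_eq_true] at h1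
    rw [h1, h1]
  by_cases h0 : ∃ p, β p = false
  swap
  · refine ⟨0, fun s p q _ _ h => absurd ?_ h⟩
    simp only [not_exists, Bool.not_eq_false] at h0
    rw [h0, h0]
  obtain ⟨p₁, hp₁, hm₁⟩ := exists_min_image (univ.filter fun p => β p = true) c (by
    obtain ⟨p, hp⟩ := h1
    exact ⟨p, by simpa using hp⟩)
  obtain ⟨p₀, hp₀, hm₀⟩ := exists_min_image (univ.filter fun p => β p = false) c (by
    obtain ⟨p, hp⟩ := h0
    exact ⟨p, by simpa using hp⟩)
  simp only [mem_filter, mem_univ, true_and] at hp₁ hm₁ hp₀ hm₀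
  refine ⟨c p₀ - c p₁, fun s p q hp hq hpq => ?_⟩
  have hFp := abs_le.mp (hF p)
  have hFq := abs_le.mp (hF q)
  cases hβp : β p <;> cases hβq : β q <;> simp only [hβp, hβq, ne_eq, not_true_eq_false] at hpq
  · have e1 := hp p₁
    have e2 := hq p
    have e3 := hm₀ p hβp
    have e4 := hm₁ q hβq
    have e5 := hp p₀
    simp only [hβp, hβq, hp₁, hp₀, if_true, Bool.false_eq_true, if_false] at e1 e2 e5
    constructor <;> linarith
  · have e1 := hp p₀
    have e2 := hq p
    have e3 := hm₁ p hβp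
    have e4 := hm₀ q hβq
    have e5 := hp p₁
    simp only [hβp, hβq, hp₁, hp₀, if_true, Bool.false_eq_true, if_false] at e1 e2 e5
    constructor <;> linarith

/-- The Laplace(ε) measure on `ℝ`. -/
noncomputable def laplaceMeasure (ε : ℝ) : Measure ℝ :=
  volume.withDensity fun x => ENNReal.ofReal (ε / 2 * Real.exp (-ε * |x|))

lemma laplace_mgf_aux {ε l : ℝ} (hl : |l| < ε) :
    Integrable (fun x => ε / 2 * Real.exp (-ε * |x|) * Real.exp (l * x)) ∧
      ∫ x, ε / 2 * Real.exp (-ε * |x|) * Real.exp (l * x) = ε ^ 2 / (ε ^ 2 - l ^ 2) := by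
  obtain ⟨h1, h2⟩ := abs_lt.mp hl
  have hpos : 0 < ε + l := by linarith
  have hneg : l - ε < 0 := by linarith
  have eL : Set.EqOn (fun x => ε / 2 * Real.exp ((ε + l) * x))
      (fun x => ε / 2 * Real.exp (-ε * |x|) * Real.exp (l * x)) (Set.Iic 0) := fun x hx => by
    simp only
    rw [abs_of_nonpos hx, mul_assoc, ← Real.exp_add]
    ring_nf
  have eR : Set.EqOn (fun x => ε / 2 * Real.exp ((l - ε) * x))
      (fun x => ε / 2 * Real.exp (-ε * |x|) * Real.exp (l * x)) (Set.Ioi 0) := fun x hx => by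
    simp only
    rw [abs_of_pos hx, mul_assoc, ← Real.exp_add]
    ring_nf
  have iL := IntegrableOn.congr_fun ((integrableOn_exp_mul_Iic hpos 0).const_mul (ε / 2)) eL
    measurableSet_Iic
  have iR := IntegrableOn.congr_fun ((integrableOn_exp_mul_Ioi hneg 0).const_mul (ε / 2)) eR
    measurableSet_Ioi
  refine ⟨?_, ?_⟩
  · rw [← integrableOn_univ, ← Set.Iic_union_Ioi (a := (0 : ℝ))]
    exact iL.union iR
  · rw [← intervalIntegral.integral_Iic_add_Ioi iL iR,
      ← setIntegral_congr_fun measurableSet_Iic eL, ← setIntegral_congr_fun measurableSet_Ioi eR,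
      integral_const_mul, integral_const_mul, integral_exp_mul_Iic hpos, integral_exp_mul_Ioi hneg]
    have : ε ^ 2 - l ^ 2 ≠ 0 := by nlinarith
    have h3 : ε + l ≠ 0 := hpos.ne'
    have h4 : l - ε ≠ 0 := hneg.ne
    simp only [mul_zero, Real.exp_zero]
    field_simp
    ring

lemma isProbabilityMeasure_laplaceMeasure {ε : ℝ} (hε : 0 < ε) :
    IsProbabilityMeasure (laplaceMeasure ε) := by
  have h := laplace_mgf_aux (ε := ε) (l := 0) (by simpa using hε)
  simp only [zero_mul, Real.exp_zero, mul_one] at h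
  constructor
  rw [laplaceMeasure, withDensity_apply _ MeasurableSet.univ, Measure.restrict_univ,
    ← ofReal_integral_eq_lintegral_ofReal h.1 (ae_of_all _ fun x => by positivity), h.2]
  simp [hε.ne']

lemma laplace_mgf {ε l : ℝ} (hl : |l| < ε) :
    Integrable (fun x => Real.exp (l * x)) (laplaceMeasure ε) ∧
      ∫ x, Real.exp (l * x) ∂(laplaceMeasure ε) = ε ^ 2 / (ε ^ 2 - l ^ 2) := by
  have hε : 0 < ε := (abs_nonneg l).trans_lt hl
  have h := laplace_mgf_aux hl
  have hm : Measurable fun x : ℝ => ENNReal.ofReal (ε / 2 * Real.exp (-ε * |x|)) := by fun_prop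
  have e : ∀ x : ℝ, (ENNReal.ofReal (ε / 2 * Real.exp (-ε * |x|))).toReal • Real.exp (l * x) =
      ε / 2 * Real.exp (-ε * |x|) * Real.exp (l * x) := fun x => by
    rw [ENNReal.toReal_ofReal (by positivity), smul_eq_mul]
  have hf : ∀ᵐ x : ℝ, ENNReal.ofReal (ε / 2 * Real.exp (-ε * |x|)) < ⊤ :=
    ae_of_all _ fun x => ENNReal.ofReal_lt_top
  refine ⟨?_, ?_⟩
  · rw [laplaceMeasure, integrable_withDensity_iff_integrable_smul' hm hf]
    simpa only [e] using h.1
  · rw [laplaceMeasure, integral_withDensity_eq_integral_toReal_smul hm hf]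
    simpa only [e] using h.2

lemma laplaceMeasure_Icc_le {ε : ℝ} (hε : 0 < ε) (a b : ℝ) :
    laplaceMeasure ε (Set.Icc a b) ≤ ENNReal.ofReal (ε / 2 * (b - a)) := by
  rw [laplaceMeasure, withDensity_apply _ measurableSet_Icc,
    ENNReal.ofReal_mul (by positivity), ← Real.volume_Icc, ← setLIntegral_const]
  refine lintegral_mono fun x => ENNReal.ofReal_le_ofReal ?_
  have : Real.exp (-ε * |x|) ≤ 1 := Real.exp_le_one_iff.mpr (by
    have := mul_nonneg hε.le (abs_nonneg x)
    linarith)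
  nlinarith

lemma laplacePi_eq_pi (ι : Type*) [Fintype ι] {ε : ℝ} (hε : 0 < ε) :
    laplacePi ι ε = Measure.pi fun _ : ι => laplaceMeasure ε := by
  have := isProbabilityMeasure_laplaceMeasure hε
  have h := (laplace_mgf_aux (ε := ε) (l := 0) (by simpa using hε)).1
  simp only [zero_mul, Real.exp_zero, mul_one] at h
  refine (Measure.pi_eq fun s hs => ?_).symm
  have hind : ∀ i, Integrable ((s i).indicator fun x => ε / 2 * Real.exp (-ε * |x|)) :=
    fun i => h.indicator (hs i)
  have h0 : ∀ i x, 0 ≤ (s i).indicator (fun x => ε / 2 * Real.exp (-ε * |x|)) x :=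
    fun i => Set.indicator_nonneg fun x _ => by positivity
  have hs' : MeasurableSet (Set.univ.pi s) := MeasurableSet.univ_pi hs
  have e : ∀ i, laplaceMeasure ε (s i) =
      ENNReal.ofReal (∫ x, (s i).indicator (fun x => ε / 2 * Real.exp (-ε * |x|)) x) := fun i => by
    rw [laplaceMeasure, withDensity_apply _ (hs i), ← lintegral_indicator (hs i),
      ofReal_integral_eq_lintegral_ofReal (hind i) (ae_of_all _ (h0 i))]
    congr 1 with x
    by_cases hx : x ∈ s i <;> simp [hx]
  simp only [e]
  rw [← ENNReal.ofReal_prod_of_nonneg fun i _ => integral_nonneg (h0 i),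
    ← integral_fintype_prod_volume_eq_prod, volume_pi,
    ofReal_integral_eq_lintegral_ofReal (Integrable.fintype_prod hind)
      (ae_of_all _ fun z => prod_nonneg fun i _ => h0 i (z i)),
    laplacePi, volume_pi, withDensity_apply _ hs',
    ← lintegral_indicator hs']
  congr 1 with z
  by_cases hz : z ∈ Set.univ.pi s
  · rw [Set.indicator_of_mem hz]
    congr 1
    exact prod_congr rfl fun i _ => (Set.indicator_of_mem (hz i (Set.mem_univ i))
      fun x => ε / 2 * Real.exp (-ε * |x|)).symm
  · rw [Set.indicator_of_notMem hz]
    simp only [Set.mem_univ_pi, not_forall] at hz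
    obtain ⟨i, hi⟩ := hz
    rw [prod_eq_zero (mem_univ i) (Set.indicator_of_notMem hi _), ENNReal.ofReal_zero]

/-- If all sections of a set in direction `i` have measure at most `C`, so has the set. -/
lemma pi_measure_le_of_sections {ι : Type*} [Fintype ι] [DecidableEq ι] (μ : Measure ℝ)
    [IsProbabilityMeasure μ] {A : Set (ι → ℝ)} (hA : MeasurableSet A) (i : ι) (C : ENNReal)
    (hC : ∀ z, μ {s | Function.update z i s ∈ A} ≤ C) :
    Measure.pi (fun _ : ι => μ) A ≤ C := by
  rw [← lintegral_indicator_one hA, lintegral_eq_lmarginal_univ 0,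
    lmarginal_erase' (μ := fun _ => μ) _ (measurable_one.indicator hA) (mem_univ i)]
  have h1 : (fun z : ι → ℝ => ∫⁻ s, A.indicator 1 (Function.update z i s) ∂μ) ≤ fun _ => C := by
    intro z
    have : ∀ s, A.indicator (1 : (ι → ℝ) → ENNReal) (Function.update z i s) =
        {s | Function.update z i s ∈ A}.indicator 1 s := fun s => rfl
    simp only [this]
    have hAz : MeasurableSet {s | Function.update z i s ∈ A} := measurable_update z hA
    rw [lintegral_indicator_one hAz]
    exact hC z
  refine (lmarginal_mono h1 0).trans ?_
  simp [lmarginal]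

/-- Total perturbation of a policy with bits `b`. -/
def bitSum {ι : Type*} [Fintype ι] (b : ι → Bool) (z : ι → ℝ) : ℝ :=
  ∑ i, if b i then z i else 0

lemma measurable_bitSum {ι : Type*} [Fintype ι] (b : ι → Bool) : Measurable (bitSum b) := by
  unfold bitSum
  refine Finset.measurable_sum _ fun i _ => ?_
  split_ifs <;> fun_prop

lemma bitSum_update {ι : Type*} [Fintype ι] [DecidableEq ι] (b : ι → Bool) (z : ι → ℝ) (i : ι)
    (s : ℝ) : bitSum b (Function.update z i s) =
      ∑ k ∈ univ.erase i, (if b k then z k else 0) + if b i then s else 0 := by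
  rw [bitSum, ← sum_erase_add _ _ (mem_univ i), Function.update_self]
  congr 1
  refine sum_congr rfl fun k hk => ?_
  rw [Function.update_of_ne (ne_of_mem_erase hk)]

lemma measurableSet_flip {ι P : Type*} [Fintype ι] [Fintype P] [Nonempty P] [LinearOrder P]
    (b : P → ι → Bool) (L L' : P → ℝ) (i : ι) :
    MeasurableSet {z : ι → ℝ | b (argminTie fun p => L p + bitSum (b p) z) i ≠
      b (argminTie fun p => L' p + bitSum (b p) z) i} := by
  have h : ∀ L : P → ℝ, Measurable fun z => b (argminTie fun p => L p + bitSum (b p) z) i :=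
    fun L => measurable_comp_argminTie (fun p => (measurable_bitSum (b p)).const_add (L p))
      fun p => b p i
  exact (measurableSet_eq_fun (h L) (h L')).compl

lemma laplacePi_flip_le {ι P : Type*} [Fintype ι] [Fintype P] [Nonempty P] [LinearOrder P]
    (b : P → ι → Bool) {L L' : P → ℝ} {F ε : ℝ} (hε : 0 < ε) (hF : ∀ p, |L' p - L p| ≤ F) (i : ι) :
    laplacePi ι ε {z | b (argminTie fun p => L p + bitSum (b p) z) i ≠
      b (argminTie fun p => L' p + bitSum (b p) z) i} ≤ ENNReal.ofReal (2 * ε * F) := by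
  classical
  have := isProbabilityMeasure_laplaceMeasure hε
  rw [laplacePi_eq_pi ι hε]
  refine pi_measure_le_of_sections _ (measurableSet_flip b L L' i) i _ fun z => ?_
  obtain ⟨ν, hν⟩ := exists_center_of_flip
    (fun p => L p + ∑ k ∈ univ.erase i, (if b p k then z k else 0))
    (fun p => L' p + ∑ k ∈ univ.erase i, (if b p k then z k else 0)) (fun p => b p i)
    (F := F) (fun p => by simpa using hF p)
  have hsub : {s | Function.update z i s ∈
      {z | b (argminTie fun p => L p + bitSum (b p) z) i ≠
        b (argminTie fun p => L' p + bitSum (b p) z) i}} ⊆ Set.Icc (ν - 2 * F) (ν + 2 * F) := by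
    intro s hs
    refine hν s _ _ (fun r => ?_) (fun r => ?_) hs
    · have h := argminTie_le (fun p => L p + bitSum (b p) (Function.update z i s)) r
      simpa only [bitSum_update, ← add_assoc] using h
    · have h := argminTie_le (fun p => L' p + bitSum (b p) (Function.update z i s)) r
      simpa only [bitSum_update, ← add_assoc] using h
  refine (measure_mono hsub).trans ((laplaceMeasure_Icc_le hε _ _).trans (le_of_eq ?_))
  congr 1
  ring

lemma bitSum_mgf {ι : Type*} [Fintype ι] (b : ι → Bool) {ε l : ℝ} (hl : |l| < ε) :
    Integrable (fun z => Real.exp (l * bitSum b z)) (laplacePi ι ε) ∧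
      ∫ z, Real.exp (l * bitSum b z) ∂(laplacePi ι ε) =
        (ε ^ 2 / (ε ^ 2 - l ^ 2)) ^ (univ.filter fun i => b i = true).card := by
  have hε : 0 < ε := (abs_nonneg l).trans_lt hl
  have := isProbabilityMeasure_laplaceMeasure hε
  have e : ∀ z : ι → ℝ, Real.exp (l * bitSum b z) =
      ∏ i, Real.exp ((if b i then l else 0) * z i) := fun z => by
    rw [← Real.exp_sum, bitSum, mul_sum]
    congr 1
    refine sum_congr rfl fun i _ => ?_
    split_ifs <;> simp
  have hi : ∀ i, |if b i then l else 0| < ε := fun i => by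
    split_ifs
    · exact hl
    · simpa using hε
  simp only [e]
  rw [laplacePi_eq_pi ι hε]
  refine ⟨Integrable.fintype_prod fun i => (laplace_mgf (hi i)).1, ?_⟩
  rw [integral_fintype_prod_eq_prod (fun i x => Real.exp ((if b i then l else 0) * x)),
    ← prod_const, prod_filter]
  refine prod_congr rfl fun i _ => ?_
  rw [(laplace_mgf (hi i)).2]
  split_ifs
  · rfl
  · simp [hε.ne']

lemma bitSum_mgf_le {ι : Type*} [Fintype ι] (b : ι → Bool) {ε l D : ℝ} (hε : 0 < ε) (hD : 1 ≤ D)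
    (hb : ((univ.filter fun i => b i = true).card : ℝ) ≤ D) (hl : l ^ 2 = ε ^ 2 / (4 * D)) :
    Integrable (fun z => Real.exp (l * bitSum b z)) (laplacePi ι ε) ∧
      ∫ z, Real.exp (l * bitSum b z) ∂(laplacePi ι ε) ≤ Real.exp (1 / 3) := by
  have hl4 : l ^ 2 ≤ ε ^ 2 / 4 := by
    rw [hl]
    gcongr
    linarith
  have hlt : |l| < ε := abs_lt_of_sq_lt_sq (by nlinarith [pow_pos hε 2]) hε.le
  obtain ⟨h1, h2⟩ := bitSum_mgf b hlt
  refine ⟨h1, h2.le.trans ?_⟩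
  have hle : ε ^ 2 / (ε ^ 2 - l ^ 2) ≤ Real.exp (1 / (3 * D)) := by
    have : ε ^ 2 / (ε ^ 2 - l ^ 2) ≤ 1 / (3 * D) + 1 := by
      rw [div_le_iff₀ (by nlinarith [pow_pos hε 2]), hl]
      have key : (1 / (3 * D) + 1) * (ε ^ 2 - ε ^ 2 / (4 * D)) - ε ^ 2 =
          ε ^ 2 * (D - 1) / (12 * D ^ 2) := by
        field_simp
        ring
      have : 0 ≤ ε ^ 2 * (D - 1) / (12 * D ^ 2) :=
        div_nonneg (mul_nonneg (sq_nonneg _) (by linarith)) (by positivity)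
      linarith
    exact this.trans (Real.add_one_le_exp _)
  calc _ ≤ (Real.exp (1 / (3 * D))) ^ (univ.filter fun i => b i = true).card :=
        pow_le_pow_left₀ (div_nonneg (sq_nonneg _) (by nlinarith [pow_pos hε 2])) hle _
    _ = Real.exp ((univ.filter fun i => b i = true).card * (1 / (3 * D))) := by
        rw [← Real.exp_nat_mul]
    _ ≤ _ := by
        refine Real.exp_le_exp.mpr ?_
        calc _ ≤ D * (1 / (3 * D)) := by gcongr
          _ = _ := by field_simp

/-- Bit-vector form of the regret bound for follow the perturbed leader. -/
lemma ftpl_regret_bitSum {ι P : Type*} [Fintype ι] [Fintype P] [Nonempty P] [LinearOrder P]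
    (b : P → ι → Bool) (hb : Function.Injective b) {D ε : ℝ} (hε : 0 < ε) (hD : 1 ≤ D)
    (hsparse : ∀ p, ((univ.filter fun i => b p i = true).card : ℝ) ≤ D)
    (hP : 2 ≤ Fintype.card P) (T : ℕ) (a : ℕ → P → ℝ) (F : ℕ → ℝ) (hF : ∀ t p, |a t p| ≤ F t)
    (p : P) :
    ∫ z, ∑ t ∈ range T, a t (argminTie fun q => ∑ τ ∈ range t, a τ q + bitSum (b q) z)
        ∂(laplacePi ι ε) ≤
      ∑ t ∈ range T, a t p + 4 * ε * Fintype.card ι * ∑ t ∈ range T, F t ^ 2 +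
        10 / ε * Real.sqrt D * Real.log (Fintype.card P) := by
  have := isProbabilityMeasure_laplaceMeasure hε
  have : IsProbabilityMeasure (laplacePi ι ε) := by
    rw [laplacePi_eq_pi ι hε]
    infer_instance
  have hF0 : ∀ t, 0 ≤ F t := fun t => (abs_nonneg _).trans (hF t p)
  set N : ℝ := (Fintype.card P : ℝ) with hN
  have hN2 : (2 : ℝ) ≤ N := by
    rw [hN]
    exact_mod_cast hP
  set lead : ℕ → (ι → ℝ) → P :=
    fun t z => argminTie fun q => ∑ τ ∈ range t, a τ q + bitSum (b q) z with hlead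
  set A : ℕ → ι → Set (ι → ℝ) := fun t i => {z | b (lead t z) i ≠ b (lead (t + 1) z) i} with hA
  have hAm : ∀ t i, MeasurableSet (A t i) := fun t i => measurableSet_flip b _ _ i
  have hAle : ∀ t i, (laplacePi ι ε).real (A t i) ≤ 2 * ε * F t := fun t i => by
    refine ENNReal.toReal_le_of_le_ofReal (by have := hF0 t; positivity)
      (laplacePi_flip_le b hε (fun q => ?_) i)
    rw [sum_range_succ, add_sub_cancel_left]
    exact hF t q
  have hSpos : 0 < Real.sqrt D := Real.sqrt_pos.mpr (by linarith)
  set l : ℝ := ε / (2 * Real.sqrt D) with hl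
  have hlpos : 0 < l := by positivity
  have hlsq : l ^ 2 = ε ^ 2 / (4 * D) := by
    rw [hl, div_pow, mul_pow, Real.sq_sqrt (by linarith)]
    norm_num
  have hmgf := fun q => bitSum_mgf_le (b q) hε hD (hsparse q) hlsq
  have hmgf' := fun q => bitSum_mgf_le (b q) hε hD (hsparse q) (l := -l) (by rw [neg_sq, hlsq])
  set α : ℝ := Real.log N + 1 / 3 with hα
  have hexpα : Real.exp (-α) * (N * Real.exp (1 / 3)) = 1 := by
    rw [hα, ← Real.exp_log (show (0 : ℝ) < N by linarith), Real.log_exp, ← Real.exp_add,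
      ← Real.exp_add]
    simp
  have hone : ∀ (κ : ℝ) (z : ι → ℝ) (q : P), κ * bitSum (b q) z ≤
      α - 1 + Real.exp (-α) * ∑ q, Real.exp (κ * bitSum (b q) z) := fun κ z q => by
    have h1 := Real.add_one_le_exp (-α + κ * bitSum (b q) z)
    have h2 : Real.exp (κ * bitSum (b q) z) ≤ ∑ q, Real.exp (κ * bitSum (b q) z) :=
      single_le_sum (f := fun q => Real.exp (κ * bitSum (b q) z))
        (fun _ _ => (Real.exp_pos _).le) (mem_univ q)
    rw [Real.exp_add] at h1
    have h3 := mul_le_mul_of_nonneg_left h2 (Real.exp_pos (-α)).le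
    linarith
  have hint : ∀ κ : ℝ, (∀ q, Integrable (fun z => Real.exp (κ * bitSum (b q) z)) (laplacePi ι ε) ∧
      ∫ z, Real.exp (κ * bitSum (b q) z) ∂(laplacePi ι ε) ≤ Real.exp (1 / 3)) →
      Integrable (fun z => α - 1 + Real.exp (-α) * ∑ q, Real.exp (κ * bitSum (b q) z))
        (laplacePi ι ε) ∧
      ∫ z, (α - 1 + Real.exp (-α) * ∑ q, Real.exp (κ * bitSum (b q) z)) ∂(laplacePi ι ε) ≤ α := by
    intro κ h
    have hs : Integrable (fun z => Real.exp (-α) * ∑ q, Real.exp (κ * bitSum (b q) z))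
        (laplacePi ι ε) := (integrable_finsetSum _ fun q _ => (h q).1).const_mul _
    refine ⟨(integrable_const _).add hs, ?_⟩
    rw [integral_add (integrable_const _) hs, integral_const_mul,
      integral_finsetSum _ fun q _ => (h q).1]
    have : ∑ q, ∫ z, Real.exp (κ * bitSum (b q) z) ∂(laplacePi ι ε) ≤ N * Real.exp (1 / 3) := by
      refine (sum_le_sum fun q _ => (h q).2).trans (le_of_eq ?_)
      simp [hN]
    have := mul_le_mul_of_nonneg_left this (Real.exp_pos (-α)).le
    rw [hexpα] at this
    simp only [integral_const, probReal_univ, one_smul]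
    linarith
  obtain ⟨i1, b1⟩ := hint l hmgf
  obtain ⟨i2, b2⟩ := hint (-l) hmgf'
  set W₁ := fun z => α - 1 + Real.exp (-α) * ∑ q, Real.exp (l * bitSum (b q) z)
  set W₂ := fun z => α - 1 + Real.exp (-α) * ∑ q, Real.exp (-l * bitSum (b q) z)
  have hstep : ∀ t z, a t (lead t z) ≤
      a t (lead (t + 1) z) + ∑ i, (A t i).indicator (fun _ => 2 * F t) z := by
    intro t z
    have hnn : ∀ i ∈ univ, 0 ≤ (A t i).indicator (fun _ => 2 * F t) z := fun i _ =>
      Set.indicator_nonneg (fun _ _ => by have := hF0 t; positivity) z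
    by_cases h : lead t z = lead (t + 1) z
    · rw [h]
      linarith [sum_nonneg hnn]
    · obtain ⟨i, hi⟩ := Function.ne_iff.mp (hb.ne h)
      have hle := single_le_sum hnn (mem_univ i)
      rw [Set.indicator_of_mem (show z ∈ A t i from hi)] at hle
      have e1 := abs_le.mp (hF t (lead t z))
      have e2 := abs_le.mp (hF t (lead (t + 1) z))
      linarith
  have hpt : ∀ z, ∑ t ∈ range T, a t (lead t z) ≤
      ∑ t ∈ range T, a t p + l⁻¹ * (W₁ z + W₂ z) +
        ∑ t ∈ range T, ∑ i, (A t i).indicator (fun _ => 2 * F t) z := by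
    intro z
    have h1 := sum_le_sum fun t (_ : t ∈ range T) => hstep t z
    rw [sum_add_distrib] at h1
    have h2 : ∑ t ∈ range T, a t (lead (t + 1) z) + bitSum (b (lead 0 z)) z ≤
        ∑ t ∈ range T, a t p + bitSum (b p) z :=
      sum_argminTie_succ_le a (fun q => bitSum (b q) z) T p
    have h3 : l * (bitSum (b p) z - bitSum (b (lead 0 z)) z) ≤ W₁ z + W₂ z := by
      have := hone l z p
      have := hone (-l) z (lead 0 z)
      simp only [W₁, W₂]
      linarith
    have h4 : bitSum (b p) z - bitSum (b (lead 0 z)) z ≤ l⁻¹ * (W₁ z + W₂ z) := by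
      rwa [inv_mul_eq_div, le_div_iff₀' hlpos]
    linarith
  have hbound : Integrable (fun z => ∑ t ∈ range T, a t (lead t z)) (laplacePi ι ε) := by
    refine integrable_finsetSum _ fun t _ => ?_
    refine Integrable.of_bound (Measurable.aestronglyMeasurable ?_) (F t)
      (ae_of_all _ fun z => hF t _)
    exact measurable_comp_argminTie
      (fun q => (measurable_bitSum (b q)).const_add (∑ τ ∈ range t, a τ q)) (a t)
  have hI : ∀ t i, Integrable ((A t i).indicator fun _ => 2 * F t) (laplacePi ι ε) :=
    fun t i => (integrable_const _).indicator (hAm t i)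
  have hI' : Integrable (fun z => ∑ t ∈ range T, ∑ i, (A t i).indicator (fun _ => 2 * F t) z)
      (laplacePi ι ε) := integrable_finsetSum _ fun t _ => integrable_finsetSum _ fun i _ => hI t i
  have hW : Integrable (fun z => l⁻¹ * (W₁ z + W₂ z)) (laplacePi ι ε) := (i1.add i2).const_mul _
  have hcW : Integrable (fun z => ∑ t ∈ range T, a t p + l⁻¹ * (W₁ z + W₂ z)) (laplacePi ι ε) :=
    (integrable_const _).add hW
  have hstab : ∫ z, ∑ t ∈ range T, ∑ i, (A t i).indicator (fun _ => 2 * F t) z ∂(laplacePi ι ε) ≤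
      4 * ε * Fintype.card ι * ∑ t ∈ range T, F t ^ 2 := by
    rw [integral_finsetSum _ fun t _ => integrable_finsetSum _ fun i _ => hI t i, mul_sum]
    refine sum_le_sum fun t _ => ?_
    rw [integral_finsetSum _ fun i _ => hI t i]
    have : ∀ i ∈ univ, ∫ z, (A t i).indicator (fun _ => 2 * F t) z ∂(laplacePi ι ε) ≤
        4 * ε * F t ^ 2 := fun i _ => by
      rw [integral_indicator_const _ (hAm t i), smul_eq_mul]
      have := mul_le_mul_of_nonneg_right (hAle t i) (by have := hF0 t; positivity : 0 ≤ 2 * F t)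
      linarith
    refine (sum_le_sum this).trans (le_of_eq ?_)
    rw [sum_const, nsmul_eq_mul, card_univ]
    ring
  have hpert : l⁻¹ * (α + α) ≤ 10 / ε * Real.sqrt D * Real.log N := by
    have hlog : Real.log 2 ≤ Real.log N := Real.log_le_log (by norm_num) hN2
    have hlog2 := Real.log_two_gt_d9
    have e : l⁻¹ = 2 / ε * Real.sqrt D := by
      rw [hl, inv_div]
      ring
    have hc : 0 ≤ 2 / ε * Real.sqrt D := by positivity
    calc l⁻¹ * (α + α) ≤ 2 / ε * Real.sqrt D * (5 * Real.log N) := by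
          rw [e]
          refine mul_le_mul_of_nonneg_left ?_ hc
          linarith
      _ = _ := by ring
  have hfinal := integral_mono hbound (hcW.add hI') hpt
  have hsplit : ∫ z, (∑ t ∈ range T, a t p + l⁻¹ * (W₁ z + W₂ z) +
      ∑ t ∈ range T, ∑ i, (A t i).indicator (fun _ => 2 * F t) z) ∂(laplacePi ι ε) =
      ∑ t ∈ range T, a t p + l⁻¹ * (∫ z, W₁ z ∂(laplacePi ι ε) + ∫ z, W₂ z ∂(laplacePi ι ε)) +
      ∫ z, ∑ t ∈ range T, ∑ i, (A t i).indicator (fun _ => 2 * F t) z ∂(laplacePi ι ε) := by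
    rw [integral_add hcW hI', integral_add (integrable_const _) hW, integral_const_mul,
      integral_add i1 i2]
    simp
  have hWle := mul_le_mul_of_nonneg_left (add_le_add b1 b2) (inv_pos.mpr hlpos).le
  refine hfinal.trans ((le_of_eq hsplit).trans ?_)
  linarith


/-- **Regret bound for Context-FTPL in the small-separator setting
(oblivious-adversary form).**  `Xs ⊆ 𝒳` is a separator of size `d` (any two
distinct policies differ on some context of `Xs`); the perturbation places
i.i.d. Laplace(ε) losses on the contexts of `Xs`.  With `π^t` the tie-broken
minimizer of the perturbed cumulative loss of the first `t` rounds, the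
expected regret is at most `4·ε·K·d·∑_t ‖f^t‖_*² + (10/ε)·√(dm)·log N`. -/
theorem context_ftpl_regret_small_separator
    {𝒳 : Type*} {P : Type*} [Fintype P] [Nonempty P] [LinearOrder P]
    {K m d N : ℕ} (hK : 1 ≤ K) (hm : 1 ≤ m)
    (Xs : Finset 𝒳) (hd : Xs.card = d)
    (hN : Fintype.card P = N) (hN2 : 2 ≤ N)
    (pol : P → 𝒳 → Fin K → Bool)
    (hsparse : ∀ p x, (Finset.univ.filter fun j => pol p x j = true).card ≤ m)
    (hsep : ∀ p q : P, p ≠ q → ∃ x ∈ Xs, pol p x ≠ pol q x)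
    {ε : ℝ} (hε : 0 < ε)
    (T : ℕ) (xs : ℕ → 𝒳) (f : ℕ → (Fin K → Bool) → ℝ) :
    (∫ z, (∑ t ∈ Finset.range T,
          f t (pol (argminTie fun p : P =>
            (∑ τ ∈ Finset.range t, f τ (pol p (xs τ))) +
              ∑ xc : {x // x ∈ Xs}, dotp (pol p ↑xc) fun j => z (xc, j)) (xs t)))
        ∂(laplacePi ({x // x ∈ Xs} × Fin K) ε)) -
      (Finset.univ.inf' Finset.univ_nonempty fun p : P =>
        ∑ t ∈ Finset.range T, f t (pol p (xs t))) ≤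
      4 * ε * (K : ℝ) * (d : ℝ) * (∑ t ∈ Finset.range T, dualNorm (f t) ^ 2) +
        10 / ε * Real.sqrt ((d : ℝ) * (m : ℝ)) * Real.log N := by
  subst hd hN
  set b : P → {x // x ∈ Xs} × Fin K → Bool := fun p i => pol p i.1 i.2 with hbdef
  have hb : Function.Injective b := fun p q h => by
    by_contra hpq
    obtain ⟨x, hx, hne⟩ := hsep p q hpq
    exact hne (funext fun j => congrFun h (⟨x, hx⟩, j))
  have hcard : 1 ≤ Xs.card := by
    obtain ⟨p, q, hpq⟩ := Fintype.one_lt_card_iff.mp (show 1 < Fintype.card P from hN2)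
    obtain ⟨x, hx, -⟩ := hsep p q hpq
    exact Finset.card_pos.mpr ⟨x, hx⟩
  have hD : (1 : ℝ) ≤ (Xs.card : ℝ) * m := by exact_mod_cast Nat.mul_pos hcard hm
  have hsp : ∀ p, ((univ.filter fun i => b p i = true).card : ℝ) ≤ (Xs.card : ℝ) * m := fun p => by
    have h : (univ.filter fun i => b p i = true).card =
        ∑ x : {x // x ∈ Xs}, (univ.filter fun j => pol p x j = true).card := by
      simp only [card_filter, hbdef, Fintype.sum_prod_type]
    have h' : (univ.filter fun i => b p i = true).card ≤ Xs.card * m := by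
      rw [h]
      refine (sum_le_card_nsmul _ _ m fun x _ => hsparse p x.1).trans (le_of_eq ?_)
      simp
    exact_mod_cast h'
  have hdot : ∀ p (z : {x // x ∈ Xs} × Fin K → ℝ),
      ∑ xc : {x // x ∈ Xs}, dotp (pol p ↑xc) (fun j => z (xc, j)) = bitSum (b p) z :=
    fun p z => by simp only [bitSum, dotp, hbdef, Fintype.sum_prod_type]
  simp only [hdot]
  obtain ⟨p, -, hp⟩ := exists_mem_eq_inf' (univ_nonempty (α := P))
    fun p => ∑ t ∈ range T, f t (pol p (xs t))
  rw [hp]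
  have h := ftpl_regret_bitSum b hb hε hD hsp hN2 T (fun t p => f t (pol p (xs t)))
    (fun t => dualNorm (f t))
    (fun t p => le_sup' (fun a => |f t a|) (mem_univ (pol p (xs t)))) p
  simp only [Fintype.card_prod, Fintype.card_coe, Fintype.card_fin, Nat.cast_mul] at h
  have e : 4 * ε * (K : ℝ) * (Xs.card : ℝ) = 4 * ε * ((Xs.card : ℝ) * K) := by ring
  rw [e]
  linarith
end
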